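/- Let m ≥ 1, let μ be a probability distribution on F_2^m with H(μ) > 0, and for each power of two n = 2^k let X be an m×n random matrix with i.i.d. columns distributed according to μ, and let Y = X·G_n (multiplication over F_2). Then for every ε > 0 and every δ > 0 there exists N such that for all n = 2^k ≥ N there exist disjoint subsets R, D ⊆ {1,…,m}×{1,…,n} of matrix entries with: (i) |({1,…,m}×{1,…,n}) \ (R ∪ D)| ≤ δn; (ii) H(Y[R]) ≥ |R|(1 − ε), i.e. Y[R] is ε-uniform; (iii) H(Y[D] | Y[D^c]) ≤ ε|D|, i.e. Y[D] is ε-deterministic given Y[D^c]; (iv) | |R| − n·H(μ) | ≤ δn and | |D| − n·(m − H(μ)) | ≤ δn. -/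

import Mathlib

open MeasureTheory ProbabilityTheory Filter
open scoped Classical

/-- Shannon entropy (in bits) of a finite-valued random variable `X` on `(Ω, μ)`:
`H(X) = ∑ₓ P(X = x) log₂ (1 / P(X = x))`. -/
noncomputable def shEnt {Ω : Type*} [MeasurableSpace Ω] (μ : Measure Ω)
    {α : Type*} [Fintype α] (X : Ω → α) : ℝ :=
  (∑ x : α, Real.negMulLog ((μ (X ⁻¹' {x})).toReal)) / Real.log 2

/-- Conditional Shannon entropy (in bits) of discrete random variables:
`H(X | Y) = H(X, Y) - H(Y)`. -/
noncomputable def cEnt {Ω : Type*} [MeasurableSpace Ω] (μ : Measure Ω)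
    {α β : Type*} [Fintype α] [Fintype β] (X : Ω → α) (Y : Ω → β) : ℝ :=
  shEnt μ (fun ω => (X ω, Y ω)) - shEnt μ Y

/-- Shannon entropy (in bits) of a distribution on a finite set. -/
noncomputable def distEnt {α : Type*} [MeasurableSpace α] [Fintype α] (ν : Measure α) : ℝ :=
  (∑ x : α, Real.negMulLog ((ν {x}).toReal)) / Real.log 2

/-- The binary entropy function `h(p) = -p log₂ p - (1-p) log₂ (1-p)`. -/
noncomputable def binEnt (p : ℝ) : ℝ :=
  (Real.negMulLog p + Real.negMulLog (1 - p)) / Real.log 2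

/-- The Bernoulli(p) distribution on `F₂` (probability `p` of the outcome `1`). -/
noncomputable def bern (p : ℝ) : Measure (ZMod 2) :=
  ENNReal.ofReal (1 - p) • Measure.dirac 0 + ENNReal.ofReal p • Measure.dirac 1

/-- `G k` is the `2^k × 2^k` matrix over `F₂` given by the `k`-fold Kronecker power of
`[[1,0],[1,1]]`, in closed form: the `(i,j)` entry is `1` iff each binary digit of `j`
is dominated by the corresponding binary digit of `i` (for the single factor
`[[1,0],[1,1]]`, the `(a,b)` entry is `1` iff the bit `b` is dominated by the bit `a`,
and the Kronecker power multiplies these bitwise conditions). -/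
def G (k : ℕ) : Matrix (Fin (2 ^ k)) (Fin (2 ^ k)) (ZMod 2) :=
  Matrix.of fun i j => if j.val &&& i.val = j.val then 1 else 0


/-! ### Entropy on a finite weighted sample space -/

/-- The total weight of the points that `f` does not separate from `x`. -/
noncomputable def fiberWeight {S α : Type*} [Fintype S] (w : S → ℝ) (f : S → α) (x : S) : ℝ :=
  ∑ y, if f y = f x then w y else 0

/-- The entropy, in nats, of `f` on the sample space `S` with point weights `w`. -/
noncomputable def wEnt {S α : Type*} [Fintype S] (w : S → ℝ) (f : S → α) : ℝ :=
  -∑ x, w x * Real.log (fiberWeight w f x)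

section Basic

variable {S T α β γ : Type*} [Fintype S] [Fintype T] {w : S → ℝ}

lemma fiberWeight_congr {f : S → α} {g : S → β} (h : ∀ x y, f x = f y ↔ g x = g y) :
    fiberWeight w f = fiberWeight w g := by
  funext x
  simp only [fiberWeight, h]

lemma fiberWeight_eq_of_eq {f : S → α} {x y : S} (h : f x = f y) :
    fiberWeight w f x = fiberWeight w f y := by
  simp only [fiberWeight, h]

lemma wEnt_congr {f : S → α} {g : S → β} (h : ∀ x y, f x = f y ↔ g x = g y) :
    wEnt w f = wEnt w g := by
  rw [wEnt, wEnt, fiberWeight_congr h]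

lemma fiberWeight_nonneg (hw : ∀ x, 0 ≤ w x) (f : S → α) (x : S) : 0 ≤ fiberWeight w f x :=
  Finset.sum_nonneg fun y _ => by split_ifs <;> simp [hw]

lemma le_fiberWeight (hw : ∀ x, 0 ≤ w x) (f : S → α) (x : S) : w x ≤ fiberWeight w f x := by
  have h := Finset.single_le_sum (f := fun y => if f y = f x then w y else 0)
    (fun y _ => by split_ifs <;> simp [hw]) (Finset.mem_univ x)
  rw [if_pos rfl] at h
  exact h

lemma fiberWeight_pos (hw : ∀ x, 0 ≤ w x) (f : S → α) {x : S} (hx : w x ≠ 0) :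
    0 < fiberWeight w f x :=
  lt_of_lt_of_le (lt_of_le_of_ne (hw x) hx.symm) (le_fiberWeight hw f x)

lemma fiberWeight_le_of_imp (hw : ∀ x, 0 ≤ w x) {f : S → α} {g : S → β}
    (h : ∀ x y, f x = f y → g x = g y) (x : S) : fiberWeight w f x ≤ fiberWeight w g x := by
  refine Finset.sum_le_sum fun y _ => ?_
  by_cases hf : f y = f x
  · simp [hf, h _ _ hf]
  · simp only [hf, if_false]
    split_ifs <;> simp [hw]

lemma wEnt_mono (hw : ∀ x, 0 ≤ w x) {f : S → α} {g : S → β}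
    (h : ∀ x y, f x = f y → g x = g y) : wEnt w g ≤ wEnt w f := by
  refine neg_le_neg (Finset.sum_le_sum fun x _ => ?_)
  by_cases hx : w x = 0
  · simp [hx]
  · exact mul_le_mul_of_nonneg_left (Real.log_le_log (fiberWeight_pos hw f hx)
      (fiberWeight_le_of_imp hw h x)) (hw x)

lemma wEnt_of_forall_eq (h1 : ∑ x, w x = 1) {f : S → α} (h : ∀ x y, f x = f y) :
    wEnt w f = 0 := by
  have : ∀ x, fiberWeight w f x = 1 := fun x => by
    rw [← h1]
    exact Finset.sum_congr rfl fun y _ => if_pos (h y x)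
  simp [wEnt, this]

lemma wEnt_comp_equiv (e : T ≃ S) (w : S → ℝ) (f : S → α) :
    wEnt (fun x => w (e x)) (fun x => f (e x)) = wEnt w f := by
  have h : ∀ x, fiberWeight (fun x => w (e x)) (fun x => f (e x)) x = fiberWeight w f (e x) :=
    fun x => Equiv.sum_comp e fun y => if f y = f (e x) then w y else 0
  simp only [wEnt, h]
  rw [Equiv.sum_comp e fun y => w y * Real.log (fiberWeight w f y)]

lemma fiberWeight_prod {w' : T → ℝ} (f : S → α) (g : T → β) (x : S × T) :
    fiberWeight (fun x : S × T => w x.1 * w' x.2) (fun x => (f x.1, g x.2)) x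
      = fiberWeight w f x.1 * fiberWeight w' g x.2 := by
  simp only [fiberWeight, Finset.sum_mul_sum, Fintype.sum_prod_type, Prod.mk.injEq]
  refine Finset.sum_congr rfl fun a _ => Finset.sum_congr rfl fun b _ => ?_
  by_cases h : f a = f x.1 <;> by_cases h' : g b = g x.2 <;> simp [h, h']

lemma wEnt_prod {w' : T → ℝ} (hw : ∀ x, 0 ≤ w x) (hw' : ∀ x, 0 ≤ w' x)
    (h1 : ∑ x, w x = 1) (h1' : ∑ x, w' x = 1) (f : S → α) (g : T → β) :
    wEnt (fun x : S × T => w x.1 * w' x.2) (fun x => (f x.1, g x.2))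
      = wEnt w f + wEnt w' g := by
  have key : ∀ x : S × T, w x.1 * w' x.2 * Real.log (fiberWeight w f x.1 * fiberWeight w' g x.2)
      = w x.1 * Real.log (fiberWeight w f x.1) * w' x.2
        + w x.1 * (w' x.2 * Real.log (fiberWeight w' g x.2)) := by
    intro x
    by_cases hx : w x.1 = 0
    · simp [hx]
    by_cases hx' : w' x.2 = 0
    · simp [hx']
    rw [Real.log_mul (fiberWeight_pos hw f hx).ne' (fiberWeight_pos hw' g hx').ne']
    ring
  simp only [wEnt, fiberWeight_prod, key, Finset.sum_add_distrib, Fintype.sum_prod_type]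
  rw [← Finset.sum_mul_sum, ← Finset.sum_mul_sum, h1, h1']
  ring

/-- The conditional expectation of `φ` given the value of `b`. -/
noncomputable def fiberMean {S β : Type*} [Fintype S] (w : S → ℝ) (b : S → β) (φ : S → ℝ)
    (x : S) : ℝ :=
  (∑ y, if b y = b x then w y * φ y else 0) / fiberWeight w b x

lemma sum_mul_fiberMean (hw : ∀ x, 0 ≤ w x) (b : S → β) (φ : S → ℝ) :
    ∑ x, w x * fiberMean w b φ x
      = ∑ x, w x * φ x := by
  simp only [fiberMean, Finset.sum_div, Finset.mul_sum]
  rw [Finset.sum_comm]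
  refine Finset.sum_congr rfl fun y _ => ?_
  by_cases hy : w y = 0
  · simp [hy]
  have hpos := fiberWeight_pos hw b hy
  have : ∀ x, w x * ((if b y = b x then w y * φ y else 0) / fiberWeight w b x)
      = (if b x = b y then w x else 0) * (w y * φ y / fiberWeight w b y) := by
    intro x
    by_cases h : b x = b y
    · rw [if_pos h, if_pos h.symm, fiberWeight_eq_of_eq h]
    · rw [if_neg h, if_neg (fun h' => h h'.symm)]
      simp
  rw [Finset.sum_congr rfl fun x _ => this x, ← Finset.sum_mul]
  change fiberWeight w b y * _ = _
  field_simp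

lemma sum_fiber_density_le (f : S → α) (a : α) :
    ∑ x, (if f x = a then w x / fiberWeight w f x else 0) ≤ 1 := by
  by_cases h : ∃ z, f z = a
  · obtain ⟨z, rfl⟩ := h
    have : ∀ x, (if f x = f z then w x / fiberWeight w f x else 0)
        = (if f x = f z then w x else 0) / fiberWeight w f z := by
      intro x
      split_ifs with h
      · rw [fiberWeight_eq_of_eq h]
      · simp
    rw [Finset.sum_congr rfl fun x _ => this x, ← Finset.sum_div]
    exact div_self_le_one _
  · push Not at h
    simp [h]

/-- Strong subadditivity of entropy. -/
lemma wEnt_submodular (hw : ∀ x, 0 ≤ w x) (h1 : ∑ x, w x = 1)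
    (f : S → α) (g : S → β) (h : S → γ) :
    wEnt w (fun x => (f x, g x, h x)) + wEnt w h
      ≤ wEnt w (fun x => (f x, h x)) + wEnt w (fun x => (g x, h x)) := by
  set A := fiberWeight w (fun x => (f x, g x, h x)) with hA
  set B := fiberWeight w h with hB
  set C := fiberWeight w (fun x => (f x, h x)) with hC
  set D := fiberWeight w (fun x => (g x, h x)) with hD
  have hB0 : ∀ x, 0 ≤ B x := fiberWeight_nonneg hw _
  have ptw : ∀ x, w x * (Real.log (C x) + Real.log (D x) - Real.log (A x) - Real.log (B x))
      ≤ w x * (C x * D x / (A x * B x)) - w x := by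
    intro x
    by_cases hx : w x = 0
    · simp [hx]
    have hAx : 0 < A x := fiberWeight_pos hw _ hx
    have hBx : 0 < B x := fiberWeight_pos hw _ hx
    have hCx : 0 < C x := fiberWeight_pos hw _ hx
    have hDx : 0 < D x := fiberWeight_pos hw _ hx
    have := Real.log_le_sub_one_of_pos (show 0 < C x * D x / (A x * B x) by positivity)
    rw [Real.log_div (by positivity) (by positivity), Real.log_mul hCx.ne' hDx.ne',
      Real.log_mul hAx.ne' hBx.ne'] at this
    nlinarith [mul_le_mul_of_nonneg_left this (hw x)]
  have total : ∑ x, w x * (C x * D x / (A x * B x)) ≤ 1 := by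
    have expand : ∀ x, w x * (C x * D x / (A x * B x)) = ∑ y, ∑ z,
        (if h z = h y then w z else 0) * w y / B y *
          (if (f x, g x, h x) = (f y, g z, h y) then w x / A x else 0) := by
      intro x
      have : w x * (C x * D x / (A x * B x)) = w x / A x / B x * (C x * D x) := by
        rw [div_div]; ring
      have prod : C x * D x = ∑ y, ∑ z, (if (f y, h y) = (f x, h x) then w y else 0) *
          (if (g z, h z) = (g x, h x) then w z else 0) := by
        rw [hC, hD, fiberWeight, fiberWeight, Finset.sum_mul_sum]
        congr!
      rw [this, prod, Finset.mul_sum]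
      refine Finset.sum_congr rfl fun y _ => ?_
      rw [Finset.mul_sum]
      refine Finset.sum_congr rfl fun z _ => ?_
      simp only [Prod.mk.injEq]
      by_cases e3 : h x = h y
      · rw [show B x = B y from fiberWeight_eq_of_eq e3]
        by_cases e1 : f x = f y <;> by_cases e2 : g x = g z <;> by_cases e4 : h z = h y <;>
          simp [e1, e2, e3, e4, eq_comm (a := f y), eq_comm (a := g z)]
        ring
      · simp [e3, eq_comm (a := h y)]
    rw [Finset.sum_congr rfl fun x _ => expand x, Finset.sum_comm]
    rw [Finset.sum_congr rfl fun y _ => Finset.sum_comm]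
    simp only [← Finset.mul_sum]
    calc _ ≤ ∑ y, ∑ z, (if h z = h y then w z else 0) * w y / B y * 1 := by
          refine Finset.sum_le_sum fun y _ => Finset.sum_le_sum fun z _ => ?_
          refine mul_le_mul_of_nonneg_left ?_ ?_
          · refine le_of_eq_of_le (Finset.sum_congr rfl fun x _ => ?_)
              (sum_fiber_density_le (w := w) (fun x => (f x, g x, h x)) (f y, g z, h y))
            congr!
          · refine div_nonneg (mul_nonneg ?_ (hw y)) (hB0 y)
            split_ifs <;> simp [hw]
      _ = ∑ y, w y * (B y / B y) := by
          refine Finset.sum_congr rfl fun y _ => ?_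
          rw [hB, fiberWeight, mul_div_assoc', Finset.mul_sum, Finset.sum_div]
          refine Finset.sum_congr rfl fun z _ => ?_
          ring
      _ ≤ ∑ y, w y * 1 := Finset.sum_le_sum fun y _ =>
          mul_le_mul_of_nonneg_left (div_self_le_one _) (hw y)
      _ = 1 := by simpa using h1
  have := Finset.sum_le_sum fun x (_ : x ∈ Finset.univ) => ptw x
  simp only [Finset.sum_sub_distrib, mul_sub, mul_add, Finset.sum_add_distrib] at this
  simp only [wEnt]
  linarith

end Basic

/-! ### Conditional entropy of a bit -/

section Bit

variable {S T α β γ : Type*} [Fintype S] [Fintype T] {w : S → ℝ}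

/-- The real-valued indicator of the nonzero element of `F₂`. -/
noncomputable def bitVal (a : ZMod 2) : ℝ := if a = 1 then 1 else 0

lemma bitVal_add (a b : ZMod 2) :
    bitVal (a + b) = bitVal a * (1 - bitVal b) + (1 - bitVal a) * bitVal b := by
  have h : ∀ c : ZMod 2, c = 0 ∨ c = 1 := by decide
  have h2 : (1 : ZMod 2) + 1 = 0 := by decide
  rcases h a with rfl | rfl <;> rcases h b with rfl | rfl <;> simp [bitVal, h2]

lemma fiberMean_one (b : S → β) {x : S} (hx : fiberWeight w b x ≠ 0) :
    fiberMean w b (fun _ => 1) x = 1 := by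
  simp only [fiberMean, mul_one]
  exact div_self hx

lemma fiberMean_congr {b : S → β} {φ ψ : S → ℝ} {x : S}
    (h : ∀ y, b y = b x → φ y = ψ y) : fiberMean w b φ x = fiberMean w b ψ x := by
  rw [fiberMean, fiberMean]
  congr 1
  refine Finset.sum_congr rfl fun y _ => ?_
  split_ifs with hy
  · rw [h y hy]
  · rfl

lemma fiberMean_add (b : S → β) (φ ψ : S → ℝ) (x : S) :
    fiberMean w b (fun y => φ y + ψ y) x = fiberMean w b φ x + fiberMean w b ψ x := by
  rw [fiberMean, fiberMean, fiberMean, ← add_div, ← Finset.sum_add_distrib]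
  congr 1
  refine Finset.sum_congr rfl fun y _ => ?_
  split_ifs <;> ring

lemma fiberMean_mul_const (b : S → β) (φ : S → ℝ) (c : ℝ) (x : S) :
    fiberMean w b (fun y => φ y * c) x = fiberMean w b φ x * c := by
  rw [fiberMean, fiberMean, div_mul_eq_mul_div, Finset.sum_mul]
  congr 1
  refine Finset.sum_congr rfl fun y _ => ?_
  split_ifs <;> ring

lemma fiberMean_one_sub (b : S → β) (φ : S → ℝ) {x : S} (hx : fiberWeight w b x ≠ 0) :
    fiberMean w b (fun y => 1 - φ y) x = 1 - fiberMean w b φ x := by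
  have h := fiberMean_add (w := w) b (fun _ => 1) (fun y => φ y * (-1)) x
  rw [fiberMean_one b hx, fiberMean_mul_const] at h
  simpa [sub_eq_add_neg] using h

lemma fiberMean_nonneg (hw : ∀ x, 0 ≤ w x) (b : S → β) {φ : S → ℝ} (hφ : ∀ y, 0 ≤ φ y)
    (x : S) : 0 ≤ fiberMean w b φ x :=
  div_nonneg (Finset.sum_nonneg fun y _ => by
    split_ifs
    · exact mul_nonneg (hw y) (hφ y)
    · exact le_rfl) (fiberWeight_nonneg hw b x)

lemma fiberMean_prod {w' : T → ℝ} (b : S → β) (c : T → γ) (φ : S → ℝ) (ψ : T → ℝ) (x : S × T) :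
    fiberMean (fun x : S × T => w x.1 * w' x.2) (fun x => (b x.1, c x.2))
      (fun x => φ x.1 * ψ x.2) x = fiberMean w b φ x.1 * fiberMean w' c ψ x.2 := by
  rw [fiberMean, fiberMean, fiberMean, fiberWeight_prod, div_mul_div_comm, Finset.sum_mul_sum,
    Fintype.sum_prod_type]
  congr 1
  refine Finset.sum_congr rfl fun y _ => Finset.sum_congr rfl fun z _ => ?_
  by_cases h : b y = b x.1 <;> by_cases h' : c z = c x.2 <;> simp [h, h']
  ring

lemma bitVal_nonneg (a : ZMod 2) : 0 ≤ bitVal a := by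
  unfold bitVal; split_ifs <;> norm_num

lemma bitVal_le_one (a : ZMod 2) : bitVal a ≤ 1 := by
  unfold bitVal; split_ifs <;> norm_num

lemma fiberMean_bitVal_mem (hw : ∀ x, 0 ≤ w x) (u : S → ZMod 2) (b : S → β) {x : S}
    (hx : fiberWeight w b x ≠ 0) :
    fiberMean w b (fun y => bitVal (u y)) x ∈ Set.Icc (0 : ℝ) 1 := by
  refine ⟨fiberMean_nonneg hw b (fun y => bitVal_nonneg _) x, ?_⟩
  have := fiberMean_nonneg hw b (φ := fun y => 1 - bitVal (u y))
    (fun y => sub_nonneg.2 (bitVal_le_one _)) x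
  rw [fiberMean_one_sub b _ hx] at this
  linarith

/-- The conditional entropy of a bit is the mean of the binary entropy of its conditional
law. -/
lemma wEnt_bit_sub (hw : ∀ x, 0 ≤ w x) (u : S → ZMod 2) (b : S → β) :
    wEnt w (fun x => (u x, b x)) - wEnt w b
      = ∑ x, w x * Real.binEntropy (fiberMean w b (fun y => bitVal (u y)) x) := by
  set q := fiberMean w b (fun y => bitVal (u y)) with hq
  have hqc : ∀ x y, b x = b y → q x = q y := by
    intro x y h
    simp only [hq, fiberMean, fiberWeight, h]
  have hfw : ∀ x, w x ≠ 0 → fiberWeight w (fun x => (u x, b x)) x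
      = fiberWeight w b x * (if u x = 1 then q x else 1 - q x) := by
    intro x hx
    have h0 := (fiberWeight_pos hw b hx).ne'
    have hq' : (if u x = 1 then q x else 1 - q x)
        = fiberMean w b (fun y => if u y = u x then 1 else 0) x := by
      split_ifs with h
      · simp only [hq, h]
        rfl
      · rw [hq, ← fiberMean_one_sub b _ h0]
        refine fiberMean_congr fun y _ => ?_
        have h01 : ∀ c : ZMod 2, c = 0 ∨ c = 1 := by decide
        have hx0 : u x = 0 := (h01 _).resolve_right h
        rcases h01 (u y) with hy | hy <;> simp [bitVal, hx0, hy]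
    rw [hq', fiberMean, mul_div_cancel₀ _ h0, fiberWeight]
    refine Finset.sum_congr rfl fun y _ => ?_
    by_cases h : b y = b x <;> by_cases h' : u y = u x <;> simp [h, h']
  have hlhs : wEnt w (fun x => (u x, b x)) - wEnt w b
      = ∑ x, w x * -Real.log (if u x = 1 then q x else 1 - q x) := by
    rw [wEnt, wEnt, neg_sub_neg, ← Finset.sum_sub_distrib]
    refine Finset.sum_congr rfl fun x _ => ?_
    by_cases hx : w x = 0
    · simp [hx]
    have h1 := fiberWeight_pos hw b hx
    have h2 := fiberWeight_pos hw (fun x => (u x, b x)) hx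
    rw [hfw x hx] at h2 ⊢
    rw [Real.log_mul h1.ne' (by rintro h; simp [h] at h2)]
    ring
  rw [hlhs, ← sum_mul_fiberMean hw b]
  refine Finset.sum_congr rfl fun x _ => ?_
  by_cases hx : w x = 0
  · simp [hx]
  have h0 := (fiberWeight_pos hw b hx).ne'
  congr 1
  have : fiberMean w b (fun y => -Real.log (if u y = 1 then q y else 1 - q y)) x
      = fiberMean w b (fun y => bitVal (u y) * (-Real.log (q x))
        + (1 - bitVal (u y)) * (-Real.log (1 - q x))) x := by
    refine fiberMean_congr fun y hy => ?_
    rw [hqc y x hy]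
    by_cases h : u y = 1 <;> simp [bitVal, h]
  rw [this, fiberMean_add, fiberMean_mul_const, fiberMean_mul_const, fiberMean_one_sub b _ h0,
    Real.binEntropy, Real.log_inv, Real.log_inv]

lemma wEnt_bit_sub_le (hw : ∀ x, 0 ≤ w x) (h1 : ∑ x, w x = 1) (u : S → ZMod 2) (b : S → β) :
    wEnt w (fun x => (u x, b x)) - wEnt w b ≤ Real.log 2 := by
  rw [wEnt_bit_sub hw]
  calc _ ≤ ∑ x, w x * Real.log 2 := Finset.sum_le_sum fun x _ =>
        mul_le_mul_of_nonneg_left Real.binEntropy_le_log_two (hw x)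
    _ = Real.log 2 := by rw [← Finset.sum_mul, h1, one_mul]

lemma negMulLog_le_sqrt {p : ℝ} (hp : 0 ≤ p) : Real.negMulLog p ≤ 2 * (√p - p) := by
  rcases hp.eq_or_lt with rfl | hp
  · simp
  have hs : 0 < √p := Real.sqrt_pos.2 hp
  have h := Real.one_sub_inv_le_log_of_pos hs
  rw [Real.log_sqrt hp.le] at h
  have hsq := Real.mul_self_sqrt hp.le
  have h2 : p * (√p)⁻¹ = √p := by
    rw [← div_eq_mul_inv, Real.div_sqrt]
  rw [Real.negMulLog]
  nlinarith [mul_le_mul_of_nonneg_left h hp.le]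

lemma binEntropy_sq_le {p : ℝ} (hp : p ∈ Set.Icc (0 : ℝ) 1) :
    Real.binEntropy p ^ 2 ≤ 4 * (p * (1 - p)) := by
  obtain ⟨h0, h1⟩ := hp
  have h1' : 0 ≤ 1 - p := sub_nonneg.2 h1
  set a := √p with ha
  set b := √(1 - p) with hb
  have ha0 : 0 ≤ a := Real.sqrt_nonneg _
  have hb0 : 0 ≤ b := Real.sqrt_nonneg _
  have ha2 : a ^ 2 = p := Real.sq_sqrt h0
  have hb2 : b ^ 2 = 1 - p := Real.sq_sqrt h1'
  have hle : Real.binEntropy p ≤ 2 * (a + b - 1) := by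
    rw [Real.binEntropy_eq_negMulLog_add_negMulLog_one_sub]
    linarith [negMulLog_le_sqrt h0, negMulLog_le_sqrt h1']
  have hab : a + b - 1 ≤ a * b := by
    have : 1 ≤ a + b := by nlinarith [mul_nonneg ha0 hb0]
    nlinarith
  have hnn := Real.binEntropy_nonneg h0 h1
  calc Real.binEntropy p ^ 2 ≤ (2 * (a * b)) ^ 2 := by gcongr; linarith
    _ = 4 * (a ^ 2 * b ^ 2) := by ring
    _ = _ := by rw [ha2, hb2]

/-- Adding an independent bit moves the binary entropy towards its maximum. -/
lemma binEntropy_conv_ge {p q : ℝ} (hp : p ∈ Set.Icc (0 : ℝ) 1) (hq : q ∈ Set.Icc (0 : ℝ) 1) :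
    Real.binEntropy p + 1 / 2 * ((Real.log 2 - Real.binEntropy p) * Real.binEntropy q ^ 2)
      ≤ Real.binEntropy (p * (1 - q) + (1 - p) * q) := by
  have half : ∀ r ∈ Set.Icc (0 : ℝ) (1 / 2), Real.binEntropy p
      + 2 * r * (Real.log 2 - Real.binEntropy p)
      ≤ Real.binEntropy (p * (1 - r) + (1 - p) * r) := by
    intro r hr
    have h := Real.strictConcave_binEntropy.concaveOn.2 hp
      (show (2⁻¹ : ℝ) ∈ Set.Icc (0 : ℝ) 1 by norm_num)
      (show 0 ≤ 1 - 2 * r by linarith [hr.2]) (show 0 ≤ 2 * r by linarith [hr.1]) (by ring)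
    simp only [smul_eq_mul, Real.binEntropy_two_inv] at h
    rw [show (1 - 2 * r) * p + 2 * r * 2⁻¹ = p * (1 - r) + (1 - p) * r by ring] at h
    linarith
  have hnn : 0 ≤ Real.log 2 - Real.binEntropy p := sub_nonneg.2 Real.binEntropy_le_log_two
  have hsq := mul_le_mul_of_nonneg_left (binEntropy_sq_le hq) hnn
  rcases le_total q (1 / 2) with h | h
  · have := half q ⟨hq.1, h⟩
    have : (Real.log 2 - Real.binEntropy p) * (q * (1 - q))
        ≤ (Real.log 2 - Real.binEntropy p) * q :=
      mul_le_mul_of_nonneg_left (by nlinarith [hq.1]) hnn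
    linarith
  · have := half (1 - q) ⟨by linarith [hq.2], by linarith⟩
    rw [← Real.binEntropy_one_sub (p * (1 - q) + (1 - p) * q)]
    rw [show 1 - (p * (1 - q) + (1 - p) * q) = p * (1 - (1 - q)) + (1 - p) * (1 - q) by ring]
    have : (Real.log 2 - Real.binEntropy p) * (q * (1 - q))
        ≤ (Real.log 2 - Real.binEntropy p) * (1 - q) :=
      mul_le_mul_of_nonneg_left (by nlinarith [hq.2]) hnn
    linarith

/-- The sum of two independent copies of a bit with side information has strictly larger
conditional entropy, unless the bit is deterministic or uniform given the side information. -/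
lemma wEnt_bit_add_ge (hw : ∀ x, 0 ≤ w x) (h1 : ∑ x, w x = 1) (u : S → ZMod 2) (b : S → β)
    {d : ℝ} (hd : d = wEnt w (fun x => (u x, b x)) - wEnt w b) :
    d + 1 / 2 * ((Real.log 2 - d) * d ^ 2)
      ≤ wEnt (fun x : S × S => w x.1 * w x.2) (fun x => (u x.1 + u x.2, b x.1, b x.2))
        - wEnt (fun x : S × S => w x.1 * w x.2) (fun x => (b x.1, b x.2)) := by
  have hw2 : ∀ x : S × S, 0 ≤ w x.1 * w x.2 := fun x => mul_nonneg (hw _) (hw _)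
  rw [wEnt_bit_sub hw] at hd
  rw [wEnt_bit_sub hw2 (fun x : S × S => u x.1 + u x.2) (fun x => (b x.1, b x.2))]
  set q := fiberMean w b (fun y => bitVal (u y)) with hq
  set H := fun x => Real.binEntropy (q x) with hH
  have jensen : d ^ 2 ≤ ∑ x, w x * H x ^ 2 := by
    rw [hd]
    exact Real.pow_arith_mean_le_arith_mean_pow_of_even _ w H (fun i _ => hw i) h1 even_two
  have hdle : d ≤ Real.log 2 := by
    rw [hd, ← wEnt_bit_sub hw]
    exact wEnt_bit_sub_le hw h1 u b
  have ptw : ∀ x : S × S, w x.1 * H x.1 * w x.2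
        + 1 / 2 * (w x.1 * (Real.log 2 - H x.1) * (w x.2 * H x.2 ^ 2))
      ≤ w x.1 * w x.2 * Real.binEntropy (fiberMean (fun x : S × S => w x.1 * w x.2)
        (fun x => (b x.1, b x.2)) (fun y => bitVal (u y.1 + u y.2)) x) := by
    intro x
    by_cases hx : w x.1 = 0
    · simp [hx]
    by_cases hx' : w x.2 = 0
    · simp [hx']
    have p1 := (fiberWeight_pos hw b hx).ne'
    have p2 := (fiberWeight_pos hw b hx').ne'
    have hconv : fiberMean (fun x : S × S => w x.1 * w x.2)
        (fun x => (b x.1, b x.2)) (fun y => bitVal (u y.1 + u y.2)) x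
        = q x.1 * (1 - q x.2) + (1 - q x.1) * q x.2 := by
      simp only [bitVal_add]
      rw [fiberMean_add, fiberMean_prod b b (fun y => bitVal (u y)) (fun y => 1 - bitVal (u y)),
        fiberMean_prod b b (fun y => 1 - bitVal (u y)) (fun y => bitVal (u y)),
        fiberMean_one_sub b _ p1, fiberMean_one_sub b _ p2]
    rw [hconv]
    have := mul_le_mul_of_nonneg_left (binEntropy_conv_ge (fiberMean_bitVal_mem hw u b p1)
      (fiberMean_bitVal_mem hw u b p2)) (hw2 x)
    refine le_trans (le_of_eq ?_) this
    simp only [hH, hq]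
    ring
  refine le_trans ?_ (Finset.sum_le_sum fun x _ => ptw x)
  rw [Finset.sum_add_distrib, ← Finset.mul_sum, Fintype.sum_prod_type, Fintype.sum_prod_type]
  simp only []
  rw [← Finset.sum_mul_sum, ← Finset.sum_mul_sum, h1, mul_one, ← hd]
  have : ∑ x, w x * (Real.log 2 - H x) = Real.log 2 - d := by
    simp only [mul_sub, Finset.sum_sub_distrib]
    rw [← Finset.sum_mul, h1, one_mul, hd]
  rw [this]
  have := mul_le_mul_of_nonneg_left jensen (sub_nonneg.2 hdle)
  linarith

end Bit

/-! ### Entropy of sets of entries -/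

section Entries

lemma restrict_eq_iff {S ι : Type*} {Y : S → ι → ZMod 2} {s : Finset ι} {x y : S} :
    ((fun e : s => Y x e) = fun e : s => Y y e) ↔ ∀ e ∈ s, Y x e = Y y e := by
  simp [funext_iff]

variable {S ι : Type*} [Fintype S] {w : S → ℝ}

/-- The entropy of the entries of `Y` indexed by `s`. -/
noncomputable def setEnt (w : S → ℝ) (Y : S → ι → ZMod 2) (s : Finset ι) : ℝ :=
  wEnt w fun x (e : s) => Y x e

lemma setEnt_mono (hw : ∀ x, 0 ≤ w x) (Y : S → ι → ZMod 2) {s t : Finset ι} (h : s ⊆ t) :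
    setEnt w Y s ≤ setEnt w Y t :=
  wEnt_mono hw fun x y hxy => by
    rw [restrict_eq_iff] at hxy ⊢
    exact fun e he => hxy e (h he)

lemma setEnt_insert (Y : S → ι → ZMod 2) (s : Finset ι) (a : ι) :
    setEnt w Y (insert a s) = wEnt w fun x => (Y x a, fun e : s => Y x e) :=
  wEnt_congr fun x y => by
    rw [restrict_eq_iff, Prod.mk.injEq, restrict_eq_iff, Finset.forall_mem_insert]

lemma setEnt_empty (h1 : ∑ x, w x = 1) (Y : S → ι → ZMod 2) : setEnt w Y ∅ = 0 :=
  wEnt_of_forall_eq h1 fun x y => by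
    rw [restrict_eq_iff]
    simp

lemma setEnt_insert_sub_anti (hw : ∀ x, 0 ≤ w x) (h1 : ∑ x, w x = 1) (Y : S → ι → ZMod 2)
    {s t : Finset ι} (h : s ⊆ t) (a : ι) :
    setEnt w Y (insert a t) - setEnt w Y t ≤ setEnt w Y (insert a s) - setEnt w Y s := by
  have key := wEnt_submodular hw h1 (fun x => Y x a) (fun x (e : t) => Y x e)
    (fun x (e : s) => Y x e)
  rw [← setEnt_insert] at key
  have e1 : wEnt w (fun x => (fun e : t => Y x e, fun e : s => Y x e)) = setEnt w Y t :=
    wEnt_congr fun x y => by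
      rw [Prod.mk.injEq, restrict_eq_iff, restrict_eq_iff]
      exact ⟨fun H => H.1, fun H => ⟨H, fun e he => H e (h he)⟩⟩
  have e2 : wEnt w (fun x => (Y x a, fun e : t => Y x e, fun e : s => Y x e))
      = setEnt w Y (insert a t) :=
    wEnt_congr fun x y => by
      rw [Prod.mk.injEq, Prod.mk.injEq, restrict_eq_iff, restrict_eq_iff, restrict_eq_iff,
        Finset.forall_mem_insert]
      exact ⟨fun H => ⟨H.1, H.2.1⟩, fun H => ⟨H.1, H.2, fun e he => H.2 e (h he)⟩⟩
  rw [e1, e2] at key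
  change _ + setEnt w Y s ≤ _ at key
  linarith

variable [Fintype ι] {r : ι → ℕ}

/-- The entries of rank smaller than that of `a`. -/
def below (r : ι → ℕ) (a : ι) : Finset ι := Finset.univ.filter fun e => r e < r a

/-- The conditional entropy of the entry `a` given the entries of smaller rank. -/
noncomputable def incrEnt (w : S → ℝ) (Y : S → ι → ZMod 2) (r : ι → ℕ) (a : ι) : ℝ :=
  setEnt w Y (insert a (below r a)) - setEnt w Y (below r a)

lemma incrEnt_nonneg (hw : ∀ x, 0 ≤ w x) (Y : S → ι → ZMod 2) (a : ι) :
    0 ≤ incrEnt w Y r a :=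
  sub_nonneg.2 (setEnt_mono hw Y (Finset.subset_insert _ _))

lemma incrEnt_le (hw : ∀ x, 0 ≤ w x) (h1 : ∑ x, w x = 1) (Y : S → ι → ZMod 2) (a : ι) :
    incrEnt w Y r a ≤ Real.log 2 := by
  rw [incrEnt, setEnt_insert]
  exact wEnt_bit_sub_le hw h1 _ _

lemma sum_incrEnt_le_setEnt (hw : ∀ x, 0 ≤ w x) (h1 : ∑ x, w x = 1) (Y : S → ι → ZMod 2)
    (hr : Function.Injective r) (s : Finset ι) :
    ∑ a ∈ s, incrEnt w Y r a ≤ setEnt w Y s := by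
  induction s using Finset.induction_on_max_value r with
  | empty => simp [setEnt_empty h1]
  | insert a s ha hmax ih =>
    rw [Finset.sum_insert ha]
    have hsub : s ⊆ below r a := fun e he => by
      simp only [below, Finset.mem_filter, Finset.mem_univ, true_and]
      exact lt_of_le_of_ne (hmax e he) fun h => ha (hr h ▸ he)
    have := setEnt_insert_sub_anti hw h1 Y hsub a
    rw [incrEnt]
    linarith

lemma setEnt_union_sub_le_sum_incrEnt (hw : ∀ x, 0 ≤ w x) (h1 : ∑ x, w x = 1)
    (Y : S → ι → ZMod 2) (s t : Finset ι)
    (h : ∀ a ∈ s, ∀ e, r e < r a → e ∈ s ∪ t) :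
    setEnt w Y (s ∪ t) - setEnt w Y t ≤ ∑ a ∈ s, incrEnt w Y r a := by
  induction s using Finset.induction_on_max_value r with
  | empty => simp
  | insert a s ha hmax ih =>
    rw [Finset.sum_insert ha, Finset.insert_union]
    have hlt : ∀ b ∈ insert a s, ∀ e, r e < r b → e ∈ s ∪ t := by
      intro b hb e he
      have hea : r e < r a := by
        rcases Finset.mem_insert.1 hb with rfl | hb
        · exact he
        · exact he.trans_le (hmax b hb)
      have := h b hb e he
      rw [Finset.insert_union] at this
      exact Finset.mem_of_mem_insert_of_ne this fun h' => by simp [h'] at hea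
    have hsub : below r a ⊆ s ∪ t := fun e he => by
      simp only [below, Finset.mem_filter, Finset.mem_univ, true_and] at he
      exact hlt a (Finset.mem_insert_self _ _) e he
    have h2 := setEnt_insert_sub_anti hw h1 Y hsub a
    have h3 := ih fun b hb => hlt b (Finset.mem_insert_of_mem hb)
    rw [incrEnt]
    linarith

lemma setEnt_sub_le_sum_incrEnt (hw : ∀ x, 0 ≤ w x) (h1 : ∑ x, w x = 1)
    (Y : S → ι → ZMod 2) {s t u : Finset ι} (hu : ∀ e, e ∈ u ↔ e ∈ s ∨ e ∈ t)
    (h : ∀ a ∈ s, ∀ e, r e < r a → e ∈ u) :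
    setEnt w Y u - setEnt w Y t ≤ ∑ a ∈ s, incrEnt w Y r a := by
  obtain rfl : u = s ∪ t := by
    ext e
    rw [hu, Finset.mem_union]
  exact setEnt_union_sub_le_sum_incrEnt hw h1 Y s t h

lemma setEnt_eq_sum_incrEnt (hw : ∀ x, 0 ≤ w x) (h1 : ∑ x, w x = 1)
    (Y : S → ι → ZMod 2) (hr : Function.Injective r) {s : Finset ι}
    (hs : ∀ a ∈ s, ∀ e, r e < r a → e ∈ s) :
    setEnt w Y s = ∑ a ∈ s, incrEnt w Y r a := by
  refine le_antisymm ?_ (sum_incrEnt_le_setEnt hw h1 Y hr _)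
  have := setEnt_union_sub_le_sum_incrEnt hw h1 Y (r := r) s ∅ (by simpa using hs)
  simpa [setEnt_empty h1] using this

end Entries

/-! ### One polarization step -/

section Polar

variable {m k : ℕ}

/-- The `m × 2^k` matrices over `F₂`, as families of columns. -/
abbrev Block (m k : ℕ) : Type := Fin (2 ^ k) → Fin m → ZMod 2

/-- The entries of `X * G k`, where `X` has the columns `x`. -/
noncomputable def polar (m k : ℕ) (x : Block m k) (e : Fin m × Fin (2 ^ k)) : ZMod 2 :=
  (Matrix.of (fun j i => x i j) * G k) e.1 e.2

/-- The weights of a block with independent columns of law `p`. -/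
noncomputable def blockWeight (p : (Fin m → ZMod 2) → ℝ) (k : ℕ) (x : Block m k) : ℝ :=
  ∏ i, p (x i)

/-- The position of an entry in column-major order. -/
def entryRank (m k : ℕ) (e : Fin m × Fin (2 ^ k)) : ℕ := finProdFinEquiv (e.2, e.1)

lemma entryRank_injective (m k : ℕ) : Function.Injective (entryRank m k) := fun a b h => by
  have := finProdFinEquiv.injective (Fin.ext h)
  rw [Prod.mk.injEq] at this
  exact Prod.ext this.2 this.1

lemma entryRank_lt_iff (a b : Fin m × Fin (2 ^ k)) :
    entryRank m k a < entryRank m k b ↔ a.2.val < b.2.val ∨ (a.2 = b.2 ∧ a.1.val < b.1.val) := by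
  have ha := a.1.isLt
  have hb := b.1.isLt
  simp only [entryRank, finProdFinEquiv_apply_val, Fin.ext_iff]
  rcases lt_trichotomy a.2.val b.2.val with h | h | h
  · simp only [h, true_or, iff_true]
    nlinarith [Nat.mul_le_mul_left m (Nat.succ_le_of_lt h)]
  · simp [h]
  · have : ¬ (a.2.val < b.2.val ∨ (a.2.val = b.2.val ∧ a.1.val < b.1.val)) := by omega
    simp only [this, iff_false, not_lt]
    nlinarith [Nat.mul_le_mul_left m (Nat.succ_le_of_lt h)]

/-- The column index `2 * i + b` attached to `(i, b)`. -/
def pairIdx (k : ℕ) : Fin (2 ^ k) × Fin 2 ≃ Fin (2 ^ (k + 1)) :=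
  finProdFinEquiv.trans (finCongr (pow_succ 2 k).symm)

lemma pairIdx_val (i : Fin (2 ^ k)) (b : Fin 2) : (pairIdx k (i, b)).val = b + 2 * i := rfl

/-- Interleaving the columns of two blocks. -/
def interleave (m k : ℕ) : Block m k × Block m k ≃ Block m (k + 1) where
  toFun y t := if ((pairIdx k).symm t).2 = 0 then y.1 ((pairIdx k).symm t).1
    else y.2 ((pairIdx k).symm t).1
  invFun x := (fun i => x (pairIdx k (i, 0)), fun i => x (pairIdx k (i, 1)))
  left_inv y := by simp
  right_inv x := by
    funext t
    obtain ⟨⟨i, b⟩, rfl⟩ := (pairIdx k).surjective t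
    fin_cases b <;> simp

lemma interleave_zero (y : Block m k × Block m k) (i : Fin (2 ^ k)) :
    interleave m k y (pairIdx k (i, 0)) = y.1 i := by
  simp [interleave]

lemma interleave_one (y : Block m k × Block m k) (i : Fin (2 ^ k)) :
    interleave m k y (pairIdx k (i, 1)) = y.2 i := by
  simp [interleave]

lemma sum_pairIdx {M : Type*} [AddCommMonoid M] (f : Fin (2 ^ (k + 1)) → M) :
    ∑ t, f t = ∑ i, (f (pairIdx k (i, 0)) + f (pairIdx k (i, 1))) := by
  rw [← Equiv.sum_comp (pairIdx k), Fintype.sum_prod_type]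
  simp only [Fin.sum_univ_two]

lemma blockWeight_interleave (p : (Fin m → ZMod 2) → ℝ) (y : Block m k × Block m k) :
    blockWeight p (k + 1) (interleave m k y) = blockWeight p k y.1 * blockWeight p k y.2 := by
  rw [blockWeight, ← Equiv.prod_comp (pairIdx k), Fintype.prod_prod_type]
  simp only [Fin.prod_univ_two, interleave_zero, interleave_one, Finset.prod_mul_distrib,
    blockWeight]

lemma land_two_mul_add_eq_iff {a b c d : ℕ} (ha : a < 2) (hb : b < 2) :
    (a + 2 * c) &&& (b + 2 * d) = a + 2 * c ↔ c &&& d = c ∧ a ≤ b := by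
  have h1 := Nat.and_div_two (a := a + 2 * c) (b := b + 2 * d)
  have h2 : ((a + 2 * c) &&& (b + 2 * d)) % 2 = a &&& b := by
    have := Nat.and_mod_two_pow (a := a + 2 * c) (b := b + 2 * d) (n := 1)
    rw [pow_one] at this
    rw [this]
    congr 1 <;> omega
  rw [show (a + 2 * c) / 2 = c by omega, show (b + 2 * d) / 2 = d by omega] at h1
  have h3 : a &&& b = a ↔ a ≤ b := by interval_cases a <;> interval_cases b <;> decide
  rw [← h3]
  omega

lemma G_pairIdx (i i' : Fin (2 ^ k)) (b b' : Fin 2) :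
    G (k + 1) (pairIdx k (i', b')) (pairIdx k (i, b)) = if b ≤ b' then G k i' i else 0 := by
  simp only [G, Matrix.of_apply, pairIdx_val, land_two_mul_add_eq_iff b.isLt b'.isLt,
    Fin.le_def]
  split_ifs <;> grind

lemma polar_zero (y : Block m k × Block m k) (j : Fin m) (i : Fin (2 ^ k)) :
    polar m (k + 1) (interleave m k y) (j, pairIdx k (i, 0))
      = polar m k y.1 (j, i) + polar m k y.2 (j, i) := by
  simp only [polar, Matrix.mul_apply, Matrix.of_apply]
  rw [sum_pairIdx, ← Finset.sum_add_distrib]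
  simp [interleave_zero, interleave_one, G_pairIdx]

lemma polar_one (y : Block m k × Block m k) (j : Fin m) (i : Fin (2 ^ k)) :
    polar m (k + 1) (interleave m k y) (j, pairIdx k (i, 1)) = polar m k y.2 (j, i) := by
  simp only [polar, Matrix.mul_apply, Matrix.of_apply]
  rw [sum_pairIdx]
  simp [interleave_zero, interleave_one, G_pairIdx]

variable {p : (Fin m → ZMod 2) → ℝ}

lemma blockWeight_nonneg (hp : ∀ v, 0 ≤ p v) (x : Block m k) : 0 ≤ blockWeight p k x :=
  Finset.prod_nonneg fun _ _ => hp _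

lemma sum_blockWeight (hp1 : ∑ v, p v = 1) (k : ℕ) : ∑ x, blockWeight p k x = 1 := by
  have := Finset.prod_univ_sum (fun _ : Fin (2 ^ k) => Finset.univ) (fun _ v => p v)
  rw [Fintype.piFinset_univ] at this
  simp only [hp1, Finset.prod_const_one] at this
  exact this.symm

/-- Transport of entropy along `interleave`. -/
lemma wEnt_interleave {α : Type*} (p : (Fin m → ZMod 2) → ℝ) (f : Block m (k + 1) → α) :
    wEnt (blockWeight p (k + 1)) f
      = wEnt (fun y : Block m k × Block m k => blockWeight p k y.1 * blockWeight p k y.2)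
        (fun y => f (interleave m k y)) := by
  rw [← wEnt_comp_equiv (interleave m k)]
  simp only [blockWeight_interleave]

/-- The entropy of the first `i` columns of the polarized block. -/
noncomputable def prefixEnt (p : (Fin m → ZMod 2) → ℝ) (k i : ℕ) : ℝ :=
  setEnt (blockWeight p k) (polar m k) (Finset.univ.filter fun e => e.2.val < i)

lemma prefixEnt_succ (hp : ∀ v, 0 ≤ p v) (hp1 : ∑ v, p v = 1) (k i : ℕ) :
    prefixEnt p (k + 1) (2 * i) = 2 * prefixEnt p k i := by
  rw [prefixEnt, setEnt, wEnt_interleave, prefixEnt, setEnt, two_mul (wEnt _ _),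
    ← wEnt_prod (blockWeight_nonneg hp) (blockWeight_nonneg hp) (sum_blockWeight hp1 k)
      (sum_blockWeight hp1 k)]
  refine wEnt_congr fun x y => ?_
  rw [restrict_eq_iff (Y := fun y => polar m (k + 1) (interleave m k y)), Prod.mk.injEq,
    restrict_eq_iff, restrict_eq_iff]
  simp only [Finset.mem_filter, Finset.mem_univ, true_and, Prod.forall]
  constructor
  · intro H
    have h2 : ∀ j (i' : Fin (2 ^ k)), i'.val < i → polar m k x.2 (j, i') = polar m k y.2 (j, i') := by
      intro j i' hi
      have := H j (pairIdx k (i', 1)) (by rw [pairIdx_val]; simp; omega)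
      rwa [polar_one, polar_one] at this
    refine ⟨fun j i' hi => ?_, h2⟩
    have := H j (pairIdx k (i', 0)) (by rw [pairIdx_val]; simp; omega)
    rw [polar_zero, polar_zero, h2 j i' hi] at this
    exact add_right_cancel this
  · rintro ⟨H1, H2⟩ j t ht
    obtain ⟨⟨i', b⟩, rfl⟩ := (pairIdx k).surjective t
    rw [pairIdx_val] at ht
    have hi : i'.val < i := by omega
    fin_cases b
    · simp only [Fin.zero_eta, polar_zero, H1 j i' hi, H2 j i' hi]
    · simp only [Fin.mk_one, polar_one, H2 j i' hi]

/-- The conditional entropy of an entry of the polarized block given the preceding ones. -/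
noncomputable def entryEnt (p : (Fin m → ZMod 2) → ℝ) (k : ℕ) (a : Fin m × Fin (2 ^ k)) : ℝ :=
  incrEnt (blockWeight p k) (polar m k) (entryRank m k) a

lemma entryEnt_nonneg (hp : ∀ v, 0 ≤ p v) (a : Fin m × Fin (2 ^ k)) : 0 ≤ entryEnt p k a :=
  incrEnt_nonneg (blockWeight_nonneg hp) _ _

lemma entryEnt_le (hp : ∀ v, 0 ≤ p v) (hp1 : ∑ v, p v = 1) (a : Fin m × Fin (2 ^ k)) :
    entryEnt p k a ≤ Real.log 2 :=
  incrEnt_le (blockWeight_nonneg hp) (sum_blockWeight hp1 k) _ _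

lemma entryEnt_pairIdx_zero_ge (hp : ∀ v, 0 ≤ p v) (hp1 : ∑ v, p v = 1)
    (j : Fin m) (i : Fin (2 ^ k)) :
    entryEnt p k (j, i)
        + 1 / 2 * ((Real.log 2 - entryEnt p k (j, i)) * entryEnt p k (j, i) ^ 2)
      ≤ entryEnt p (k + 1) (j, pairIdx k (i, 0)) := by
  have hw := blockWeight_nonneg (k := k) hp
  have h1 := sum_blockWeight hp1 k
  have hd : entryEnt p k (j, i) = wEnt (blockWeight p k) (fun x => (polar m k x (j, i),
      fun e : below (entryRank m k) (j, i) => polar m k x e))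
      - wEnt (blockWeight p k) (fun x (e : below (entryRank m k) (j, i)) => polar m k x e) := by
    rw [entryEnt, incrEnt, setEnt_insert]
    rfl
  refine (wEnt_bit_add_ge hw h1 _ _ hd).trans ?_
  set W := fun y : Block m k × Block m k => blockWeight p k y.1 * blockWeight p k y.2 with hW
  have hW0 : ∀ y, 0 ≤ W y := fun y => mul_nonneg (hw _) (hw _)
  have hW1 : ∑ y, W y = 1 := by
    rw [hW, Fintype.sum_prod_type]
    simp only []
    rw [← Finset.sum_mul_sum, h1, one_mul]
  rw [entryEnt, incrEnt, setEnt_insert, setEnt, wEnt_interleave, wEnt_interleave]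
  simp only [polar_zero]
  set u := fun y : Block m k × Block m k => polar m k y.1 (j, i) + polar m k y.2 (j, i) with hu
  set f := fun (y : Block m k × Block m k)
    (e : below (entryRank m (k + 1)) (j, pairIdx k (i, 0))) =>
      polar m (k + 1) (interleave m k y) e with hf
  set b := fun (x : Block m k) (e : below (entryRank m k) (j, i)) => polar m k x e with hb
  have hdet : ∀ x y : Block m k × Block m k, b x.1 = b y.1 → b x.2 = b y.2 → f x = f y := by
    intro x y H1 H2
    rw [hb, restrict_eq_iff] at H1 H2
    rw [hf, restrict_eq_iff (Y := fun y => polar m (k + 1) (interleave m k y))]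
    simp only [below, Finset.mem_filter, Finset.mem_univ, true_and, entryRank_lt_iff,
      Prod.forall] at H1 H2 ⊢
    intro j' t ht
    obtain ⟨⟨i', c⟩, rfl⟩ := (pairIdx k).surjective t
    rw [(pairIdx k).injective.eq_iff, Prod.mk.injEq, pairIdx_val, pairIdx_val] at ht
    simp only [Fin.val_zero] at ht
    have hi : i'.val < i.val ∨ (i' = i ∧ j'.val < j.val) := by
      rcases ht with ht | ht
      · left; omega
      · exact Or.inr ⟨ht.1.1, ht.2⟩
    fin_cases c
    · simp only [Fin.zero_eta, polar_zero, H1 j' i' hi, H2 j' i' hi]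
    · simp only [Fin.mk_one, polar_one, H2 j' i' hi]
  have key := wEnt_submodular hW0 hW1 u (fun y => (b y.1, b y.2)) f
  have e1 : wEnt W (fun y => ((b y.1, b y.2), f y)) = wEnt W (fun y => (b y.1, b y.2)) :=
    wEnt_congr fun x y => by
      simp only [Prod.mk.injEq]
      exact ⟨fun H => H.1, fun H => ⟨H, hdet x y H.1 H.2⟩⟩
  have e2 : wEnt W (fun y => (u y, (b y.1, b y.2), f y))
      = wEnt W (fun y => (u y, b y.1, b y.2)) :=
    wEnt_congr fun x y => by
      simp only [Prod.mk.injEq]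
      exact ⟨fun H => ⟨H.1, H.2.1⟩, fun H => ⟨H.1, H.2, hdet x y H.2.1 H.2.2⟩⟩
  rw [e1, e2] at key
  linarith

/-- The conditional entropy of a column of the polarized block given the preceding ones. -/
noncomputable def colEnt (p : (Fin m → ZMod 2) → ℝ) (k : ℕ) (i : Fin (2 ^ k)) : ℝ :=
  ∑ j, entryEnt p k (j, i)

lemma prefixEnt_eq_sum (hp : ∀ v, 0 ≤ p v) (hp1 : ∑ v, p v = 1) (k i : ℕ) :
    prefixEnt p k i = ∑ t, if t.val < i then colEnt p k t else 0 := by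
  rw [prefixEnt, setEnt_eq_sum_incrEnt (blockWeight_nonneg hp) (sum_blockWeight hp1 k) _
    (entryRank_injective m k)]
  · rw [Finset.sum_filter, Fintype.sum_prod_type, Finset.sum_comm]
    refine Finset.sum_congr rfl fun t _ => ?_
    simp only []
    split_ifs with h
    · rfl
    · simp
  · intro a ha e he
    rw [entryRank_lt_iff] at he
    simp only [Finset.mem_filter, Finset.mem_univ, true_and, Fin.ext_iff] at ha he ⊢
    omega

lemma eq_of_forall_sum_lt_eq {n : ℕ} {f g : Fin n → ℝ}
    (h : ∀ i : ℕ, ∑ t, (if t.val < i then f t else 0) = ∑ t, (if t.val < i then g t else 0))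
    (i : Fin n) : f i = g i := by
  have step : ∀ f : Fin n → ℝ, ∑ t, (if t.val < i.val + 1 then f t else 0)
      - ∑ t, (if t.val < i.val then f t else 0) = f i := by
    intro f
    rw [← Finset.sum_sub_distrib, Finset.sum_eq_single i]
    · simp
    · intro t _ ht
      have : t.val ≠ i.val := fun h => ht (Fin.ext h)
      by_cases h' : t.val < i.val
      · simp [h', Nat.lt_succ_of_lt h']
      · simp [h', show ¬ t.val < i.val + 1 by omega]
    · simp
  rw [← step f, ← step g, h, h]

lemma colEnt_add (hp : ∀ v, 0 ≤ p v) (hp1 : ∑ v, p v = 1) (i : Fin (2 ^ k)) :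
    colEnt p (k + 1) (pairIdx k (i, 0)) + colEnt p (k + 1) (pairIdx k (i, 1))
      = 2 * colEnt p k i := by
  refine eq_of_forall_sum_lt_eq (f := fun i => colEnt p (k + 1) (pairIdx k (i, 0))
    + colEnt p (k + 1) (pairIdx k (i, 1))) (g := fun i => 2 * colEnt p k i) (fun n => ?_) i
  have h := prefixEnt_succ hp hp1 k n
  rw [prefixEnt_eq_sum hp hp1, prefixEnt_eq_sum hp hp1, sum_pairIdx, Finset.mul_sum] at h
  refine Eq.trans (Finset.sum_congr rfl fun t _ => ?_)
    (h.trans (Finset.sum_congr rfl fun t _ => ?_))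
  · have v0 := pairIdx_val t 0
    have v1 := pairIdx_val t 1
    rw [Fin.val_zero] at v0
    rw [Fin.val_one] at v1
    by_cases ht : t.val < n
    · rw [if_pos ht, if_pos (by omega), if_pos (by omega)]
    · rw [if_neg ht, if_neg (by omega), if_neg (by omega), add_zero]
  · split_ifs <;> simp

lemma sum_entryEnt (hp : ∀ v, 0 ≤ p v) (hp1 : ∑ v, p v = 1) (k : ℕ) :
    ∑ a, entryEnt p k a = 2 ^ k * wEnt p id := by
  have h0 : ∑ a, entryEnt p k a = prefixEnt p k (2 ^ k) := by
    rw [prefixEnt_eq_sum hp hp1, Fintype.sum_prod_type, Finset.sum_comm]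
    exact Finset.sum_congr rfl fun t _ => by rw [if_pos t.isLt]; rfl
  rw [h0]
  clear h0
  induction k with
  | zero =>
    have : Unique (Fin (2 ^ 0)) := inferInstanceAs (Unique (Fin 1))
    rw [prefixEnt, setEnt, ← wEnt_comp_equiv (Equiv.funUnique (Fin (2 ^ 0)) (Fin m → ZMod 2)) p]
    have hw : (fun x => p (Equiv.funUnique (Fin (2 ^ 0)) (Fin m → ZMod 2) x))
        = blockWeight p 0 := by
      funext x
      rw [blockWeight, Fintype.prod_unique]
      rfl
    rw [hw, pow_zero (2 : ℝ), one_mul]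
    refine wEnt_congr fun x y => ?_
    have hpol : ∀ (x : Block m 0) j t, polar m 0 x (j, t) = x this.default j := by
      intro x j t
      rw [polar, Matrix.mul_apply, Fintype.sum_unique, Matrix.of_apply, Subsingleton.elim t this.default]
      simp only [G, Matrix.of_apply, Nat.and_self, if_true, mul_one]
    rw [restrict_eq_iff]
    simp only [Finset.mem_filter, Finset.mem_univ, true_and, Prod.forall, hpol, id,
      Equiv.funUnique_apply, funext_iff]
    exact ⟨fun H j => H j this.default (by simp), fun H j t _ => H j⟩
  | succ k ih =>
    rw [pow_succ', prefixEnt_succ hp hp1, ih, pow_succ']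
    ring

end Polar

/-! ### Polarization -/

section Limit

variable {m : ℕ} {p : (Fin m → ZMod 2) → ℝ}

/-- The lower bound of `wEnt_bit_add_ge` for the gain in entropy of a bit in one step. -/
noncomputable def entGain (d : ℝ) : ℝ := 1 / 2 * ((Real.log 2 - d) * d ^ 2)

/-- The mean square of the conditional column entropies. -/
noncomputable def meanSqEnt (p : (Fin m → ZMod 2) → ℝ) (k : ℕ) : ℝ :=
  (∑ i, colEnt p k i ^ 2) / 2 ^ k

lemma entGain_nonneg {d : ℝ} (hd : d ≤ Real.log 2) : 0 ≤ entGain d := by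
  have := sub_nonneg.2 hd
  unfold entGain
  positivity

lemma entGain_le_colEnt_sub (hp : ∀ v, 0 ≤ p v) (hp1 : ∑ v, p v = 1) {k : ℕ} (j : Fin m)
    (i : Fin (2 ^ k)) :
    entGain (entryEnt p k (j, i)) ≤ colEnt p (k + 1) (pairIdx k (i, 0)) - colEnt p k i := by
  rw [colEnt, colEnt, ← Finset.sum_sub_distrib]
  have hle : ∀ j, entGain (entryEnt p k (j, i))
      ≤ entryEnt p (k + 1) (j, pairIdx k (i, 0)) - entryEnt p k (j, i) := fun j => by
    have := entryEnt_pairIdx_zero_ge hp hp1 j i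
    unfold entGain
    linarith
  refine (hle j).trans (Finset.single_le_sum (f := fun j =>
    entryEnt p (k + 1) (j, pairIdx k (i, 0)) - entryEnt p k (j, i)) (fun j _ => ?_)
    (Finset.mem_univ j))
  exact (entGain_nonneg (entryEnt_le hp hp1 _)).trans (hle j)

lemma sum_entGain_sq_le (hp : ∀ v, 0 ≤ p v) (hp1 : ∑ v, p v = 1) (k : ℕ) :
    (∑ a, entGain (entryEnt p k a) ^ 2) / 2 ^ k ≤ m * (meanSqEnt p (k + 1) - meanSqEnt p k) := by
  have h1 : meanSqEnt p (k + 1) - meanSqEnt p k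
      = (∑ i, (colEnt p (k + 1) (pairIdx k (i, 0)) - colEnt p k i) ^ 2) / 2 ^ k := by
    rw [meanSqEnt, meanSqEnt, sum_pairIdx, pow_succ (2 : ℝ) k, div_sub_div _ _ (by positivity)
      (by positivity), div_eq_div_iff (by positivity) (by positivity)]
    have : ∑ i, (colEnt p (k + 1) (pairIdx k (i, 0)) ^ 2
        + colEnt p (k + 1) (pairIdx k (i, 1)) ^ 2)
        = 2 * ∑ i, colEnt p k i ^ 2
          + 2 * ∑ i, (colEnt p (k + 1) (pairIdx k (i, 0)) - colEnt p k i) ^ 2 := by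
      rw [Finset.mul_sum, Finset.mul_sum, ← Finset.sum_add_distrib]
      refine Finset.sum_congr rfl fun i _ => ?_
      rw [eq_sub_of_add_eq' (colEnt_add hp hp1 i)]
      ring
    rw [this]
    ring
  rw [h1, mul_div_assoc']
  gcongr
  rw [Fintype.sum_prod_type]
  calc _ ≤ ∑ _j : Fin m, ∑ i, (colEnt p (k + 1) (pairIdx k (i, 0)) - colEnt p k i) ^ 2 := by
        refine Finset.sum_le_sum fun j _ => Finset.sum_le_sum fun i _ => ?_
        exact pow_le_pow_left₀ (entGain_nonneg (entryEnt_le hp hp1 _))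
          (entGain_le_colEnt_sub hp hp1 j i) 2
    _ = _ := by simp

lemma meanSqEnt_le (hp : ∀ v, 0 ≤ p v) (hp1 : ∑ v, p v = 1) (k : ℕ) :
    meanSqEnt p k ≤ (m * Real.log 2) ^ 2 := by
  rw [meanSqEnt, div_le_iff₀ (by positivity)]
  calc _ ≤ ∑ _i : Fin (2 ^ k), (m * Real.log 2) ^ 2 := by
        refine Finset.sum_le_sum fun i _ => ?_
        refine pow_le_pow_left₀ (Finset.sum_nonneg fun j _ => entryEnt_nonneg hp _) ?_ 2
        calc _ ≤ ∑ _j : Fin m, Real.log 2 := Finset.sum_le_sum fun j _ => entryEnt_le hp hp1 _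
          _ = _ := by simp
    _ = _ := by simp [mul_comm]

lemma tendsto_sum_entGain_sq (hp : ∀ v, 0 ≤ p v) (hp1 : ∑ v, p v = 1) :
    Tendsto (fun k => (∑ a, entGain (entryEnt p k a) ^ 2) / 2 ^ k) atTop (nhds 0) := by
  rcases Nat.eq_zero_or_pos m with rfl | hm
  · simp
  have hmono : Monotone (meanSqEnt p) := monotone_nat_of_le_succ fun k => by
    have h0 : 0 ≤ (∑ a, entGain (entryEnt p k a) ^ 2) / 2 ^ k := by positivity
    have h := h0.trans (sum_entGain_sq_le hp hp1 k)
    exact sub_nonneg.1 (nonneg_of_mul_nonneg_right h (by exact_mod_cast hm))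
  have hlim := tendsto_atTop_ciSup hmono
    ⟨(m * Real.log 2) ^ 2, by rintro _ ⟨k, rfl⟩; exact meanSqEnt_le hp hp1 k⟩
  have hdiff := ((hlim.comp (tendsto_add_atTop_nat 1)).sub hlim).const_mul (m : ℝ)
  rw [sub_self, mul_zero] at hdiff
  exact squeeze_zero (fun k => by positivity) (sum_entGain_sq_le hp hp1) hdiff

lemma eventually_card_unpolarized_le (hp : ∀ v, 0 ≤ p v) (hp1 : ∑ v, p v = 1)
    {η δ : ℝ} (hη : 0 < η) (hδ : 0 < δ) :
    ∀ᶠ k in atTop, ((Finset.univ.filter fun a : Fin m × Fin (2 ^ k) =>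
      η < entryEnt p k a ∧ entryEnt p k a < Real.log 2 - η).card : ℝ) ≤ δ * 2 ^ k := by
  set c : ℝ := (1 / 2 * (η * η ^ 2)) ^ 2 with hc
  have hc0 : 0 < c := by positivity
  filter_upwards [(tendsto_sum_entGain_sq hp hp1).eventually
    (gt_mem_nhds (show 0 < δ * c by positivity))] with k hk
  rw [div_lt_iff₀ (by positivity)] at hk
  set B := Finset.univ.filter fun a : Fin m × Fin (2 ^ k) =>
      η < entryEnt p k a ∧ entryEnt p k a < Real.log 2 - η with hB
  have h1 : (B.card : ℝ) * c ≤ ∑ a, entGain (entryEnt p k a) ^ 2 := by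
    calc (B.card : ℝ) * c = ∑ _a ∈ B, c := by simp
      _ ≤ ∑ a ∈ B, entGain (entryEnt p k a) ^ 2 := by
        refine Finset.sum_le_sum fun a ha => ?_
        obtain ⟨ha1, ha2⟩ := (Finset.mem_filter.1 ha).2
        have : η ≤ Real.log 2 - entryEnt p k a := by linarith
        rw [hc, entGain]
        gcongr
        exact hη.le.trans this
      _ ≤ _ := Finset.sum_le_sum_of_subset_of_nonneg (Finset.subset_univ _)
        fun a _ _ => sq_nonneg _
  have h2 : (B.card : ℝ) * c ≤ δ * 2 ^ k * c := by linarith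
  exact le_of_mul_le_mul_right h2 hc0

/-- Extraction of the nearly uniform and of the nearly deterministic entries. -/
lemma eventually_exists_extraction (hm : 1 ≤ m) (hp : ∀ v, 0 ≤ p v) (hp1 : ∑ v, p v = 1)
    {ε δ : ℝ} (hε : 0 < ε) (hδ : 0 < δ) :
    ∀ᶠ k in atTop, ∃ R D : Finset (Fin m × Fin (2 ^ k)), Disjoint R D ∧
      ((Finset.univ \ (R ∪ D)).card : ℝ) ≤ δ * 2 ^ k ∧
      (R.card : ℝ) * (1 - ε) * Real.log 2 ≤ setEnt (blockWeight p k) (polar m k) R ∧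
      setEnt (blockWeight p k) (polar m k) Finset.univ
        - setEnt (blockWeight p k) (polar m k) Dᶜ ≤ ε * D.card * Real.log 2 ∧
      |(R.card : ℝ) - 2 ^ k * (wEnt p id / Real.log 2)| ≤ δ * 2 ^ k ∧
      |(D.card : ℝ) - 2 ^ k * (m - wEnt p id / Real.log 2)| ≤ δ * 2 ^ k := by
  have hm0 : (0 : ℝ) < m := by exact_mod_cast hm
  have hlog : 0 < Real.log 2 := Real.log_pos one_lt_two
  obtain ⟨t, ht0, htε, ht4, htδ⟩ : ∃ t : ℝ, 0 < t ∧ t ≤ ε ∧ t ≤ 1 / 4 ∧ t * m ≤ δ / 4 := by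
    refine ⟨min ε (min (1 / 4) (δ / 4 / m)), by positivity, min_le_left _ _,
      (min_le_right _ _).trans (min_le_left _ _), ?_⟩
    rw [← le_div_iff₀ hm0]
    exact (min_le_right _ _).trans (min_le_right _ _)
  filter_upwards [eventually_card_unpolarized_le hp hp1 (mul_pos ht0 hlog)
    (show 0 < δ / 4 by positivity)] with k hk
  set d := entryEnt p k with hd
  set R := Finset.univ.filter fun a => Real.log 2 - t * Real.log 2 ≤ d a with hR
  set D := Finset.univ.filter fun a => d a ≤ t * Real.log 2 with hD
  have hdisj : Disjoint R D := Finset.disjoint_filter.2 fun a _ h1 h2 => by nlinarith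
  have hcompl : Finset.univ \ (R ∪ D) = Finset.univ.filter fun a =>
      t * Real.log 2 < d a ∧ d a < Real.log 2 - t * Real.log 2 := by
    ext a
    simp only [hR, hD, Finset.mem_sdiff, Finset.mem_univ, Finset.mem_union, Finset.mem_filter,
      true_and, not_or, not_le]
    exact and_comm
  set B := Finset.univ \ (R ∪ D) with hB
  rw [← hcompl] at hk
  have hw := blockWeight_nonneg (k := k) hp
  have hw1 := sum_blockWeight hp1 k
  have hinj := entryRank_injective m k
  have hn : (0 : ℝ) < 2 ^ k := by positivity
  have hRsum : (R.card : ℝ) * (1 - t) * Real.log 2 ≤ ∑ a ∈ R, d a := by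
    calc _ = ∑ _a ∈ R, (Real.log 2 - t * Real.log 2) := by
          rw [Finset.sum_const, nsmul_eq_mul]; ring
      _ ≤ _ := Finset.sum_le_sum fun a ha => (Finset.mem_filter.1 ha).2
  have hRsum' : ∑ a ∈ R, d a ≤ R.card * Real.log 2 := by
    calc _ ≤ ∑ _a ∈ R, Real.log 2 := Finset.sum_le_sum fun a _ => entryEnt_le hp hp1 a
      _ = _ := by simp
  have hDsum : ∑ a ∈ D, d a ≤ t * D.card * Real.log 2 := by
    calc _ ≤ ∑ _a ∈ D, t * Real.log 2 :=
          Finset.sum_le_sum fun a ha => (Finset.mem_filter.1 ha).2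
      _ = _ := by rw [Finset.sum_const, nsmul_eq_mul]; ring
  have hBsum : ∑ a ∈ B, d a ≤ B.card * Real.log 2 := by
    calc _ ≤ ∑ _a ∈ B, Real.log 2 := Finset.sum_le_sum fun a _ => entryEnt_le hp hp1 a
      _ = _ := by simp
  have hDsum0 : 0 ≤ ∑ a ∈ D, d a := Finset.sum_nonneg fun a _ => entryEnt_nonneg hp a
  have hBsum0 : 0 ≤ ∑ a ∈ B, d a := Finset.sum_nonneg fun a _ => entryEnt_nonneg hp a
  have htotal : ∑ a ∈ B, d a + (∑ a ∈ R, d a + ∑ a ∈ D, d a) = 2 ^ k * wEnt p id := by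
    rw [← sum_entryEnt hp hp1 k, ← Finset.sum_union hdisj,
      Finset.sum_sdiff (Finset.subset_univ (R ∪ D))]
  have hcard : (B.card : ℝ) + (R.card + D.card) = m * 2 ^ k := by
    have h := Finset.card_sdiff_add_card_eq_card (Finset.subset_univ (R ∪ D))
    rw [Finset.card_union_of_disjoint hdisj] at h
    simp only [Finset.card_univ, Fintype.card_prod, Fintype.card_fin] at h
    exact_mod_cast h
  set h := wEnt p id / Real.log 2 with hh
  have hmul : 2 ^ k * wEnt p id = 2 ^ k * h * Real.log 2 := by
    rw [hh]; field_simp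
  have hupper : 2 ^ k * h ≤ B.card + (R.card + t * D.card) := by
    refine le_of_mul_le_mul_right ?_ hlog
    linarith
  have hlower : (R.card : ℝ) * (1 - t) ≤ 2 ^ k * h := by
    refine le_of_mul_le_mul_right ?_ hlog
    linarith
  have hR0 : (0 : ℝ) ≤ R.card := Nat.cast_nonneg _
  have hD0 : (0 : ℝ) ≤ D.card := Nat.cast_nonneg _
  have hB0 : (0 : ℝ) ≤ B.card := Nat.cast_nonneg _
  have htn : t * (m * 2 ^ k) ≤ δ / 4 * 2 ^ k := by
    rw [← mul_assoc]
    exact mul_le_mul_of_nonneg_right htδ hn.le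
  have htR : t * R.card ≤ t * (m * 2 ^ k) := mul_le_mul_of_nonneg_left (by linarith) ht0.le
  have htD : t * D.card ≤ t * (m * 2 ^ k) := mul_le_mul_of_nonneg_left (by linarith) ht0.le
  have hδn : 0 < δ * 2 ^ k := by positivity
  refine ⟨R, D, hdisj, by linarith, ?_, ?_, ?_, ?_⟩
  · refine le_trans ?_ (hRsum.trans (sum_incrEnt_le_setEnt hw hw1 _ hinj R))
    gcongr
  · have := setEnt_sub_le_sum_incrEnt hw hw1 (polar m k) (r := entryRank m k) (s := D)
      (t := Dᶜ) (u := Finset.univ) (fun e => by simp [em]) (fun _ _ _ _ => Finset.mem_univ _)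
    refine this.trans (hDsum.trans ?_)
    gcongr
  · rw [abs_le]
    constructor <;> linarith
  · rw [abs_le]
    constructor <;> linarith

end Limit

/-! ### Transfer to random variables -/

section Transfer

lemma wEnt_eq_sum_negMulLog {S α : Type*} [Fintype S] [Fintype α] (w : S → ℝ) (f : S → α) :
    wEnt w f = ∑ a, Real.negMulLog (∑ x, if f x = a then w x else 0) := by
  have : ∀ a, Real.negMulLog (∑ x, if f x = a then w x else 0)
      = ∑ x, if f x = a then -(w x * Real.log (fiberWeight w f x)) else 0 := by
    intro a
    rw [Real.negMulLog, neg_mul, Finset.sum_mul, ← Finset.sum_neg_distrib]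
    refine Finset.sum_congr rfl fun x _ => ?_
    split_ifs with h
    · subst h; rfl
    · simp
  simp only [this]
  rw [Finset.sum_comm]
  simp [wEnt]

lemma shEnt_comp {Ω S α : Type*} [MeasurableSpace Ω] [Fintype S] [MeasurableSpace S]
    [MeasurableSingletonClass S] [Fintype α] (μ : Measure Ω) [IsProbabilityMeasure μ]
    {Z : Ω → S} (hZ : Measurable Z) (f : S → α) :
    shEnt μ (fun ω => f (Z ω)) = wEnt (fun x => (μ.map Z {x}).toReal) f / Real.log 2 := by
  rw [shEnt, wEnt_eq_sum_negMulLog]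
  congr 1
  refine Finset.sum_congr rfl fun a _ => ?_
  congr 1
  have h := sum_measureReal_preimage_singleton (μ := μ) (Finset.univ.filter fun x => f x = a)
    (f := Z) (fun y _ => hZ (measurableSet_singleton y))
  have hpre : (fun ω => f (Z ω)) ⁻¹' {a} = Z ⁻¹' ↑(Finset.univ.filter fun x => f x = a) := by
    ext ω
    simp
  rw [hpre]
  change μ.real _ = _
  rw [← h, Finset.sum_filter]
  refine Finset.sum_congr rfl fun x _ => ?_
  rw [Measure.map_apply hZ (measurableSet_singleton x)]
  rfl

lemma distEnt_eq_wEnt {α : Type*} [MeasurableSpace α] [Fintype α] (ν : Measure α) :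
    distEnt ν = wEnt (fun v => (ν {v}).toReal) id / Real.log 2 := by
  rw [distEnt, wEnt_eq_sum_negMulLog]
  simp

end Transfer

/-- matrix polarization: extracting randomness and dependencies.
Let `μ` be a distribution on `F₂^m` with `H(μ) > 0`, `X` an `m × n` random matrix with
i.i.d. columns of law `μ` (`n = 2^k`) and `Y = X ⬝ G_n` over `F₂`. For all `ε, δ > 0` and
all large enough `n = 2^k` there are disjoint sets `R, D` of entries covering all but `δn`
entries, with `Y[R]` `ε`-uniform, `Y[D]` `ε`-deterministic given `Y[Dᶜ]`,
`|R| ≈ n H(μ)` and `|D| ≈ n (m - H(μ))` up to `δn`. -/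
theorem statement1 (m : ℕ) (hm : 1 ≤ m)
    (ν : Measure (Fin m → ZMod 2)) [IsProbabilityMeasure ν] (hνpos : 0 < distEnt ν)
    (Ω : ℕ → Type) [∀ k, MeasurableSpace (Ω k)] (μ : ∀ k, Measure (Ω k))
    (hprob : ∀ k, IsProbabilityMeasure (μ k))
    (X : ∀ k, Ω k → Fin m → Fin (2 ^ k) → ZMod 2)
    (hmeas : ∀ k, Measurable (X k))
    (hiid : ∀ k, (μ k).map (fun ω => fun j i => X k ω i j)
      = Measure.pi fun _ : Fin (2 ^ k) => ν)
    (ε δ : ℝ) (hε : 0 < ε) (hδ : 0 < δ) :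
    ∃ N : ℕ, ∀ k : ℕ, N ≤ 2 ^ k →
      ∃ R D : Finset (Fin m × Fin (2 ^ k)), Disjoint R D ∧
        ((Finset.univ \ (R ∪ D)).card : ℝ) ≤ δ * 2 ^ k ∧
        (R.card : ℝ) * (1 - ε)
          ≤ shEnt (μ k) (fun ω (e : R) => (Matrix.of (X k ω) * G k) e.1.1 e.1.2) ∧
        cEnt (μ k) (fun ω (e : D) => (Matrix.of (X k ω) * G k) e.1.1 e.1.2)
            (fun ω (e : (Dᶜ : Finset (Fin m × Fin (2 ^ k)))) =>
              (Matrix.of (X k ω) * G k) e.1.1 e.1.2)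
          ≤ ε * D.card ∧
        |(R.card : ℝ) - 2 ^ k * distEnt ν| ≤ δ * 2 ^ k ∧
        |(D.card : ℝ) - 2 ^ k * ((m : ℝ) - distEnt ν)| ≤ δ * 2 ^ k := by
  set p : (Fin m → ZMod 2) → ℝ := fun v => (ν {v}).toReal with hpdef
  have hp : ∀ v, 0 ≤ p v := fun v => ENNReal.toReal_nonneg
  have hp1 : ∑ v, p v = 1 := by
    have := sum_measureReal_singleton (μ := ν) (Finset.univ : Finset (Fin m → ZMod 2))
    rw [Finset.coe_univ, probReal_univ] at this
    exact this
  obtain ⟨K, hK⟩ := eventually_atTop.1 (eventually_exists_extraction hm hp hp1 hε hδ)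
  refine ⟨2 ^ K, fun k hk => ?_⟩
  obtain ⟨R, D, hdisj, hcompl, hR, hD, hRcard, hDcard⟩ :=
    hK k ((Nat.pow_le_pow_iff_right one_lt_two).1 hk)
  have := hprob k
  have hlog : 0 < Real.log 2 := Real.log_pos one_lt_two
  have hZ : Measurable fun ω => fun j i => X k ω i j := by
    refine measurable_pi_lambda _ fun j => measurable_pi_lambda _ fun i => ?_
    exact (measurable_pi_apply j).comp ((measurable_pi_apply i).comp (hmeas k))
  have hent : ∀ {α : Type} [Fintype α] (f : Block m k → α),
      shEnt (μ k) (fun ω => f fun j i => X k ω i j)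
        = wEnt (blockWeight p k) f / Real.log 2 := by
    intro α _ f
    rw [shEnt_comp (μ k) hZ f, hiid k]
    congr 2
    funext x
    rw [Measure.pi_singleton, ENNReal.toReal_prod]
    rfl
  have hpair : wEnt (blockWeight p k)
      (fun x => (fun e : D => polar m k x e, fun e : (Dᶜ : Finset _) => polar m k x e))
      = setEnt (blockWeight p k) (polar m k) Finset.univ :=
    wEnt_congr fun x y => by
      rw [Prod.mk.injEq, restrict_eq_iff, restrict_eq_iff, restrict_eq_iff,
        ← Finset.union_compl D, Finset.forall_mem_union]
  rw [distEnt_eq_wEnt]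
  refine ⟨R, D, hdisj, hcompl, ?_, ?_, hRcard, hDcard⟩
  · refine le_of_le_of_eq ?_ (hent fun x (e : R) => polar m k x e).symm
    rwa [le_div_iff₀ hlog]
  · have h1 := hent fun x => (fun e : D => polar m k x e,
      fun e : (Dᶜ : Finset _) => polar m k x e)
    have h2 := hent fun x (e : (Dᶜ : Finset _)) => polar m k x e
    rw [hpair] at h1
    refine le_of_eq_of_le (congrArg₂ (· - ·) h1 h2) ?_
    rw [← sub_div, div_le_iff₀ hlog]
    exact hD
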